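/- Let n ≥ 1 and let a = (a_0,…,a_n) be positive even integers. Let m = (0,1,1,…,1), i.e. m_0 = 0 and m_j = 1 for 1 ≤ j ≤ n. Then the set L_m = {z ∈ ℂ^{n+1} : z_0^{a_0}+⋯+z_n^{a_n} = 1 and e^{2πi m_j/a_j}·conj(z_j) = z_j for all j}, with its subspace topology, is homotopy equivalent to the 0-sphere S^0, i.e. to a discrete two-point space. -/

import Mathlib

noncomputable section

/-- The reflection `R_m^a : ℂ → ℂ`, `z ↦ e^{2πim/a} ⬝ conj z`. -/
def refl1 (a m : ℕ) (z : ℂ) : ℂ :=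
  Complex.exp (2 * (Real.pi : ℂ) * Complex.I * (m : ℂ) / (a : ℂ)) * (starRingEnd ℂ) z

/-- The real Lagrangian `L_𝐦` inside the Milnor fiber `V(𝐚) ⊆ ℂ^{n+1}`. -/
def LSet (n : ℕ) (a m : Fin (n + 1) → ℕ) : Set (Fin (n + 1) → ℂ) :=
  {z | ∑ j, z j ^ a j = 1 ∧ ∀ j, refl1 (a j) (m j) (z j) = z j}

/-- Reflections commute with multiplication by real scalars. -/
lemma refl1_ofReal_mul (a m : ℕ) (r : ℝ) (z : ℂ) :
    refl1 a m (r * z) = r * refl1 a m z := by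
  simp only [refl1, map_mul, Complex.conj_ofReal]
  ring

lemma refl1_zero_eq_iff (a : ℕ) (z : ℂ) : refl1 a 0 z = z ↔ ((z.re : ℝ) : ℂ) = z := by
  simp [refl1, ← Complex.conj_eq_iff_re]

lemma pow_eq_norm_pow_of_refl1_zero {a : ℕ} (he : Even a) {z : ℂ} (hz : refl1 a 0 z = z) :
    z ^ a = ((‖z‖ ^ a : ℝ) : ℂ) := by
  rw [refl1_zero_eq_iff] at hz
  rw [← hz, Complex.norm_real, Real.norm_eq_abs, he.pow_abs, Complex.ofReal_pow]

lemma pow_eq_neg_norm_pow_of_refl1_one {a : ℕ} (ha : 0 < a) (he : Even a) {z : ℂ}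
    (hz : refl1 a 1 z = z) : z ^ a = -((‖z‖ ^ a : ℝ) : ℂ) := by
  have ha' : (a : ℂ) ≠ 0 := by exact_mod_cast ha.ne'
  set w : ℂ := Complex.exp ((Real.pi / a : ℝ) * Complex.I) with hw
  have hnorm : ‖w‖ = 1 := Complex.norm_exp_ofReal_mul_I _
  have hwa : w ^ a = -1 := by
    rw [hw, ← Complex.exp_nat_mul, ← Complex.exp_pi_mul_I]
    congr 1
    push_cast
    field_simp
  have hww : w * (starRingEnd ℂ) w = 1 := by
    rw [Complex.mul_conj, Complex.normSq_eq_norm_sq, hnorm]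
    simp
  have hz' : w * w * (starRingEnd ℂ) z = z := by
    have hexp : w * w = Complex.exp (2 * Real.pi * Complex.I * (1 : ℕ) / a) := by
      rw [hw, ← Complex.exp_add]
      congr 1
      push_cast
      ring
    rw [hexp]
    exact hz
  obtain ⟨r, hr⟩ : ∃ r : ℝ, (starRingEnd ℂ) w * z = r := by
    rw [← Complex.conj_eq_iff_real]
    simp only [map_mul, Complex.conj_conj]
    linear_combination (starRingEnd ℂ) w * hz' - w * (starRingEnd ℂ) z * hww
  have hzr : z = w * r := by linear_combination w * hr - z * hww
  rw [hzr, mul_pow, hwa, norm_mul, hnorm, one_mul, Complex.norm_real, Real.norm_eq_abs,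
    he.pow_abs]
  simp

/-- The real quantity `1 + ∑_{j ≥ 1} |z_j|^{a_j}`. -/
def tailSum (n : ℕ) (a : Fin (n + 1) → ℕ) (z : Fin (n + 1) → ℂ) : ℝ :=
  1 + ∑ j : Fin n, ‖z j.succ‖ ^ a j.succ

lemma one_le_tailSum (n : ℕ) (a : Fin (n + 1) → ℕ) (z : Fin (n + 1) → ℂ) :
    1 ≤ tailSum n a z :=
  le_add_of_nonneg_right (Finset.sum_nonneg fun _ _ => by positivity)

/-- On the fixed locus of the reflections, the Milnor fiber equation is an equation between
norms. -/
lemma mem_LSet_iff {n : ℕ} {a m : Fin (n + 1) → ℕ} (ha : ∀ j, 0 < a j)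
    (heven : ∀ j, Even (a j)) (hm : ∀ j, m j = if j = 0 then 0 else 1) (z : Fin (n + 1) → ℂ) :
    z ∈ LSet n a m ↔
      ‖z 0‖ ^ a 0 = tailSum n a z ∧ ∀ j, refl1 (a j) (m j) (z j) = z j := by
  refine and_congr_left fun h => ?_
  have h0 : z 0 ^ a 0 = ((‖z 0‖ ^ a 0 : ℝ) : ℂ) :=
    pow_eq_norm_pow_of_refl1_zero (heven 0) (by simpa [hm] using h 0)
  have hs (j : Fin n) : z j.succ ^ a j.succ = -((‖z j.succ‖ ^ a j.succ : ℝ) : ℂ) :=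
    pow_eq_neg_norm_pow_of_refl1_one (ha _) (heven _)
      (by simpa [hm, Fin.succ_ne_zero] using h j.succ)
  rw [Fin.sum_univ_succ, h0, Finset.sum_congr rfl fun j _ => hs j, Finset.sum_neg_distrib,
    ← sub_eq_add_neg, sub_eq_iff_eq_add, tailSum, ← Complex.ofReal_inj]
  push_cast
  rfl

/-- Scale the coordinates `z_1, …, z_n` by `s` and adjust `|z_0|`, keeping the direction of `z_0`,
so that the norm equation of `LSet` holds. -/
def shrink (n : ℕ) (a : Fin (n + 1) → ℕ) (s : ℝ) (z : Fin (n + 1) → ℂ) : Fin (n + 1) → ℂ :=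
  Fin.cons (((tailSum n a (fun j => s * z j) ^ ((a 0 : ℝ)⁻¹) / ‖z 0‖ : ℝ) : ℂ) * z 0)
    fun j => s * z j.succ

section Shrink

variable {n : ℕ} {a m : Fin (n + 1) → ℕ}

lemma ne_zero_of_mem_LSet (ha : ∀ j, 0 < a j) (heven : ∀ j, Even (a j))
    (hm : ∀ j, m j = if j = 0 then 0 else 1) {z : Fin (n + 1) → ℂ} (hz : z ∈ LSet n a m) :
    z 0 ≠ 0 := by
  intro h
  have h1 := ((mem_LSet_iff ha heven hm z).1 hz).1
  rw [h, norm_zero, zero_pow (ha 0).ne'] at h1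
  linarith [one_le_tailSum n a z]

lemma shrink_mem_LSet (ha : ∀ j, 0 < a j) (heven : ∀ j, Even (a j))
    (hm : ∀ j, m j = if j = 0 then 0 else 1) (s : ℝ) {z : Fin (n + 1) → ℂ}
    (hz : z ∈ LSet n a m) : shrink n a s z ∈ LSet n a m := by
  have h0 : ‖z 0‖ ≠ 0 := norm_ne_zero_iff.2 (ne_zero_of_mem_LSet ha heven hm hz)
  have hT : 0 ≤ tailSum n a fun j => s * z j := zero_le_one.trans (one_le_tailSum _ _ _)
  rw [mem_LSet_iff ha heven hm] at hz ⊢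
  refine ⟨?_, Fin.cases ?_ fun j => ?_⟩
  · have hnorm : ‖shrink n a s z 0‖ = tailSum n a (fun j => s * z j) ^ ((a 0 : ℝ)⁻¹) := by
      rw [shrink, Fin.cons_zero, norm_mul, Complex.norm_real,
        Real.norm_of_nonneg (by positivity), div_mul_cancel₀ _ h0]
    rw [hnorm, Real.rpow_inv_natCast_pow hT (ha 0).ne']
    rfl
  · rw [shrink, Fin.cons_zero, refl1_ofReal_mul, hz.2]
  · rw [shrink, Fin.cons_succ, refl1_ofReal_mul, hz.2]

lemma shrink_one (ha : ∀ j, 0 < a j) (heven : ∀ j, Even (a j))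
    (hm : ∀ j, m j = if j = 0 then 0 else 1) {z : Fin (n + 1) → ℂ} (hz : z ∈ LSet n a m) :
    shrink n a 1 z = z := by
  have h0 : ‖z 0‖ ≠ 0 := norm_ne_zero_iff.2 (ne_zero_of_mem_LSet ha heven hm hz)
  have h1 := ((mem_LSet_iff ha heven hm z).1 hz).1
  funext j
  refine Fin.cases ?_ (fun j => ?_) j
  · simp [shrink, ← h1, Real.pow_rpow_inv_natCast (norm_nonneg _) (ha 0).ne', h0]
  · simp [shrink]

lemma shrink_zero (ha : ∀ j, 0 < a j) (z : Fin (n + 1) → ℂ) :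
    shrink n a 0 z = Fin.cons (((‖z 0‖⁻¹ : ℝ) : ℂ) * z 0) 0 := by
  funext j
  refine Fin.cases ?_ (fun j => ?_) j
  · simp [shrink, tailSum, (ha _).ne']
  · simp [shrink]

lemma continuous_shrink (ha : ∀ j, 0 < a j) (heven : ∀ j, Even (a j))
    (hm : ∀ j, m j = if j = 0 then 0 else 1) :
    Continuous fun p : unitInterval × LSet n a m => shrink n a p.1 p.2 := by
  have h0 (p : unitInterval × LSet n a m) : ‖p.2.1 0‖ ≠ 0 :=
    norm_ne_zero_iff.2 (ne_zero_of_mem_LSet ha heven hm p.2.2)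
  have hz (j : Fin (n + 1)) : Continuous fun p : unitInterval × LSet n a m => p.2.1 j :=
    (continuous_apply j).comp (continuous_subtype_val.comp continuous_snd)
  have hs : Continuous fun p : unitInterval × LSet n a m => ((p.1 : ℝ) : ℂ) := by fun_prop
  have hT : Continuous fun p : unitInterval × LSet n a m =>
      tailSum n a fun j => ((p.1 : ℝ) : ℂ) * p.2.1 j := by
    unfold tailSum
    exact continuous_const.add
      (continuous_finsetSum _ fun j _ => ((hs.mul (hz j.succ)).norm.pow _))
  refine continuous_pi (Fin.cases ?_ fun j => ?_)
  · simp only [shrink, Fin.cons_zero]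
    refine (Complex.continuous_ofReal.comp (Continuous.div ?_ (hz 0).norm h0)).mul (hz 0)
    exact hT.rpow_const fun p => Or.inr (by positivity)
  · simp only [shrink, Fin.cons_succ]
    exact hs.mul (hz j.succ)

end Shrink

/-- The point `(±1, 0, …, 0)`. -/
def signPoint (n : ℕ) (b : Bool) : Fin (n + 1) → ℂ :=
  Fin.cons (if b then 1 else -1) 0

lemma signPoint_mem_LSet {n : ℕ} {a m : Fin (n + 1) → ℕ} (ha : ∀ j, 0 < a j)
    (heven : ∀ j, Even (a j)) (hm : ∀ j, m j = if j = 0 then 0 else 1) (b : Bool) :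
    signPoint n b ∈ LSet n a m := by
  rw [mem_LSet_iff ha heven hm]
  refine ⟨?_, Fin.cases ?_ fun j => ?_⟩
  · cases b <;> simp [signPoint, tailSum, (ha _).ne']
  · cases b <;> simp [signPoint, refl1, hm]
  · simp [signPoint, refl1]

/-- The points of `LSet` whose zeroth coordinate is positive form a clopen subset. -/
lemma isClopen_re_pos {n : ℕ} {a m : Fin (n + 1) → ℕ} (ha : ∀ j, 0 < a j)
    (heven : ∀ j, Even (a j)) (hm : ∀ j, m j = if j = 0 then 0 else 1) :
    IsClopen {z : LSet n a m | 0 < (z.1 0).re} := by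
  have hc : Continuous fun z : LSet n a m =>
      (z.1 0).re :=
    Complex.continuous_re.comp ((continuous_apply 0).comp continuous_subtype_val)
  refine ⟨?_, isOpen_lt continuous_const hc⟩
  convert isClosed_le continuous_const hc using 3 with z
  refine ⟨le_of_lt, fun h => lt_of_le_of_ne h fun h' => ?_⟩
  have hre : (((z.1 0).re : ℝ) : ℂ) = z.1 0 :=
    (refl1_zero_eq_iff (a 0) _).1 (by simpa [hm] using z.2.2 0)
  apply ne_zero_of_mem_LSet ha heven hm z.2
  rw [← hre, ← h', Complex.ofReal_zero]

/-- **Theorem**: if all exponents `a_j` are even and `𝐦 = (0,1,…,1)`, then the real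
Lagrangian `L_𝐦` is homotopy equivalent to the two-point discrete space `S^0`
(realized here as `Bool` with the discrete topology). -/
theorem real_lagrangian_homotopy_equiv_S0 (n : ℕ) (hn : 1 ≤ n) (a : Fin (n + 1) → ℕ)
    (ha : ∀ j, 0 < a j) (heven : ∀ j, Even (a j))
    (m : Fin (n + 1) → ℕ) (hm : ∀ j, m j = if j = 0 then 0 else 1) :
    Nonempty (ContinuousMap.HomotopyEquiv (↥(LSet n a m)) Bool) := by
  set U : Set (LSet n a m) := {z | 0 < (z.1 0).re}
  let f : C(LSet n a m, Bool) :=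
    ⟨U.boolIndicator, (continuous_boolIndicator_iff_isClopen U).2 (isClopen_re_pos ha heven hm)⟩
  let g : C(Bool, LSet n a m) :=
    ⟨fun b => ⟨signPoint n b, signPoint_mem_LSet ha heven hm b⟩, continuous_of_discreteTopology⟩
  have hfg : f.comp g = ContinuousMap.id Bool := by
    ext b
    cases b <;> simp [f, g, U, Set.boolIndicator, signPoint, not_lt.2 zero_le_one]
  let H : ContinuousMap.Homotopy (g.comp f) (ContinuousMap.id (LSet n a m)) :=
    { toFun := fun p => ⟨shrink n a p.1 p.2, shrink_mem_LSet ha heven hm _ p.2.2⟩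
      continuous_toFun := (continuous_shrink ha heven hm).subtype_mk _
      map_zero_left := fun z => by
        apply Subtype.ext
        have hre : (((z.1 0).re : ℝ) : ℂ) = z.1 0 :=
          (refl1_zero_eq_iff (a 0) _).1 (by simpa [hm] using z.2.2 0)
        have h0 := ne_zero_of_mem_LSet ha heven hm z.2
        have hx : (z.1 0).re ≠ 0 := fun h => h0 (by rw [← hre, h, Complex.ofReal_zero])
        simp only [Set.Icc.coe_zero, shrink_zero ha, f, g, ContinuousMap.comp_apply,
          ContinuousMap.coe_mk, signPoint]
        congr 1
        rw [← hre, Complex.norm_real, ← Complex.ofReal_mul, Real.norm_eq_abs]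
        by_cases hpos : 0 < (z.1 0).re
        · simp [Set.boolIndicator, U, hpos, abs_of_pos hpos, hx]
        · have hneg : (z.1 0).re < 0 := lt_of_le_of_ne (not_lt.1 hpos) hx
          simp [Set.boolIndicator, U, hpos, abs_of_neg hneg, hx, inv_neg]
      map_one_left := fun z => Subtype.ext (by
        simpa using shrink_one ha heven hm z.2) }
  exact ⟨⟨f, g, ⟨H⟩, hfg ▸ ContinuousMap.Homotopic.refl _⟩⟩
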